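/- Let n ≥ 10 and let C_1, …, C_{n−1} ∈ GL_{n+1}(ℂ) be an irreducible representation of B_n of dimension n+1. Then there exist a nonzero complex number y and invertible matrices Ĉ_1, …, Ĉ_{n−1} ∈ GL_{n+1}(ℂ) forming an irreducible representation of B_n of dimension n+1 with corank 3 (that is, rank(Ĉ_1 − I) = 3), such that C_i = y·Ĉ_i for all i = 1, …, n−1. -/

import Mathlib

structure Br {V : Type} [AddCommGroup V] [Module ℂ V] (N : ℕ) (C : ℕ → Module.End ℂ V) : Prop where
  unit : ∀ i, i < N → IsUnit (C i)
  comm : ∀ i j, i + 2 ≤ j → j < N → C i * C j = C j * C i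
  braid : ∀ i, i + 1 < N → C i * C (i + 1) * C i = C (i + 1) * C i * C (i + 1)

def AllEq {V : Type} [AddCommGroup V] [Module ℂ V] (N : ℕ) (C : ℕ → Module.End ℂ V) : Prop :=
  ∀ i, i < N → ∀ j, j < N → C i = C j

def Irr {V : Type} [AddCommGroup V] [Module ℂ V] (N : ℕ) (C : ℕ → Module.End ℂ V) : Prop :=
  ∀ p : Submodule ℂ V, (∀ i, i < N → ∀ v ∈ p, C i v ∈ p) → p = ⊥ ∨ p = ⊤

/-- every braid tuple with `N` generators on a space of dimension `≤ d` is constant -/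
def PP (N d : ℕ) : Prop :=
  ∀ (V : Type) [AddCommGroup V] [Module ℂ V] [FiniteDimensional ℂ V] (C : ℕ → Module.End ℂ V),
    Br N C → Module.finrank ℂ V ≤ d → AllEq N C

section
variable {V : Type} [AddCommGroup V] [Module ℂ V]
variable {W : Type} [AddCommGroup W] [Module ℂ W]

open Classical in
noncomputable def resC (p : Submodule ℂ V) (C : ℕ → Module.End ℂ V) (i : ℕ) : Module.End ℂ p :=
  if h : ∀ v ∈ p, C i v ∈ p then (C i).restrict h else 1

open Classical in
noncomputable def quoC (p : Submodule ℂ V) (C : ℕ → Module.End ℂ V) (i : ℕ) : Module.End ℂ (V ⧸ p) :=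
  if h : ∀ v ∈ p, C i v ∈ p then p.mapQ p (C i) h else 1

lemma resC_apply {p : Submodule ℂ V} {C : ℕ → Module.End ℂ V} {i : ℕ}
    (h : ∀ v ∈ p, C i v ∈ p) (x : p) : ((resC p C i x : p) : V) = C i x := by
  simp only [resC, dif_pos h]
  rfl

lemma quoC_apply {p : Submodule ℂ V} {C : ℕ → Module.End ℂ V} {i : ℕ}
    (h : ∀ v ∈ p, C i v ∈ p) (x : V) : quoC p C i (p.mkQ x) = p.mkQ (C i x) := by
  simp only [quoC, dif_pos h]
  rfl

lemma Br.of_inj [FiniteDimensional ℂ W] {N : ℕ} {C : ℕ → Module.End ℂ V}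
    {C' : ℕ → Module.End ℂ W} (f : W →ₗ[ℂ] V)
    (hf : Function.Injective f) (h : ∀ i, i < N → ∀ x, f (C' i x) = C i (f x)) (hC : Br N C) :
    Br N C' := by
  refine ⟨fun i hi => ?_, fun i j hij hj => ?_, fun i hi => ?_⟩
  · rw [LinearMap.isUnit_iff_ker_eq_bot, LinearMap.ker_eq_bot]
    have h1 := ((Module.End.isUnit_iff _).1 (hC.unit i hi)).1
    intro x y hxy
    apply hf; apply h1
    rw [← h i hi, ← h i hi, hxy]
  · ext x
    apply hf
    have := LinearMap.congr_fun (hC.comm i j hij hj) (f x)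
    simpa [h i (by omega), h j hj] using this
  · ext x
    apply hf
    have := LinearMap.congr_fun (hC.braid i hi) (f x)
    simpa [h i (by omega), h (i+1) hi] using this

lemma Br.of_surj [FiniteDimensional ℂ W] {N : ℕ} {C : ℕ → Module.End ℂ V}
    {C' : ℕ → Module.End ℂ W} (f : V →ₗ[ℂ] W)
    (hf : Function.Surjective f) (h : ∀ i, i < N → ∀ x, C' i (f x) = f (C i x)) (hC : Br N C) :
    Br N C' := by
  refine ⟨fun i hi => ?_, fun i j hij hj => ?_, fun i hi => ?_⟩
  · rw [LinearMap.isUnit_iff_range_eq_top, LinearMap.range_eq_top]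
    have h1 := ((Module.End.isUnit_iff _).1 (hC.unit i hi)).2
    intro x
    obtain ⟨y, rfl⟩ := hf x
    obtain ⟨z, rfl⟩ := h1 y
    exact ⟨f z, h i hi z⟩
  · ext x
    obtain ⟨x, rfl⟩ := hf x
    have := congrArg f (LinearMap.congr_fun (hC.comm i j hij hj) x)
    simpa [h i (by omega), h j hj] using this
  · ext x
    obtain ⟨x, rfl⟩ := hf x
    have := congrArg f (LinearMap.congr_fun (hC.braid i hi) x)
    simpa [h i (by omega), h (i+1) hi] using this

lemma Br.res [FiniteDimensional ℂ V] {N : ℕ} {C : ℕ → Module.End ℂ V} (hC : Br N C)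
    (p : Submodule ℂ V) (h : ∀ i, i < N → ∀ v ∈ p, C i v ∈ p) : Br N (resC p C) :=
  hC.of_inj p.subtype p.injective_subtype (fun i hi x => resC_apply (h i hi) x)

lemma Br.quo [FiniteDimensional ℂ V] {N : ℕ} {C : ℕ → Module.End ℂ V} (hC : Br N C)
    (p : Submodule ℂ V) (h : ∀ i, i < N → ∀ v ∈ p, C i v ∈ p) : Br N (quoC p C) :=
  hC.of_surj p.mkQ p.mkQ_surjective (fun i hi x => quoC_apply (h i hi) x)

lemma Br.shift {N k : ℕ} {C : ℕ → Module.End ℂ V} (hC : Br (N + k) C) :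
    Br N (fun i => C (i + k)) := by
  refine ⟨fun i hi => hC.unit _ (by omega), fun i j hij hj => hC.comm _ _ (by omega) (by omega),
    fun i hi => ?_⟩
  have := hC.braid (i + k) (by omega)
  rwa [show i + k + 1 = i + 1 + k by omega] at this

lemma Br.mono {N M : ℕ} {C : ℕ → Module.End ℂ V} (hC : Br N C) (h : M ≤ N) : Br M C :=
  ⟨fun i hi => hC.unit _ (by omega), fun i j hij hj => hC.comm _ _ (by omega) (by omega),
    fun i hi => hC.braid i (by omega)⟩

lemma Br.far {N : ℕ} {C : ℕ → Module.End ℂ V} (hC : Br N C) {i j : ℕ} (hi : i < N) (hj : j < N)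
    (h : i + 2 ≤ j ∨ j + 2 ≤ i ∨ i = j) : C i * C j = C j * C i := by
  rcases h with h | h | h
  · exact hC.comm i j h hj
  · exact (hC.comm j i h hi).symm
  · rw [h]

/-- commuting adjacent generators are equal -/
lemma Br.eq_of_comm {N : ℕ} {C : ℕ → Module.End ℂ V} (hC : Br N C) {i : ℕ} (hi : i + 1 < N)
    (h : C i * C (i + 1) = C (i + 1) * C i) : C i = C (i + 1) := by
  have hb := hC.braid i hi
  have hu := (hC.unit i (by omega)).mul (hC.unit (i+1) hi)
  have : (C i * C (i+1)) * C i = (C i * C (i+1)) * C (i + 1) := by rw [hb, h]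
  exact hu.mul_left_cancel this

lemma allEq_of_adj {N : ℕ} {C : ℕ → Module.End ℂ V} (h : ∀ i, i + 1 < N → C i = C (i + 1)) :
    AllEq N C := by
  have : ∀ i, i < N → C i = C 0 := by
    intro i
    induction i with
    | zero => intro _; rfl
    | succ k ih => intro hk; rw [← h k hk, ih (by omega)]
  intro i hi j hj
  rw [this i hi, this j hj]

lemma Br.ext [FiniteDimensional ℂ V] {N : ℕ} (hN : 4 ≤ N) {C : ℕ → Module.End ℂ V} (hC : Br N C)
    (p : Submodule ℂ V) (h : ∀ i, i < N → ∀ v ∈ p, C i v ∈ p)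
    (h1 : AllEq N (resC p C)) (h2 : AllEq N (quoC p C)) : AllEq N C := by
  have e1 : ∀ i j, i < N → j < N → ∀ v ∈ p, C i v = C j v := by
    intro i j hi hj v hv
    have := congrArg Subtype.val (LinearMap.congr_fun (h1 i hi j hj) ⟨v, hv⟩)
    rwa [resC_apply (h i hi), resC_apply (h j hj)] at this
  have e2 : ∀ i j, i < N → j < N → ∀ v, C i v - C j v ∈ p := by
    intro i j hi hj v
    have := LinearMap.congr_fun (h2 i hi j hj) (p.mkQ v)
    rw [quoC_apply (h i hi), quoC_apply (h j hj)] at this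
    simpa [Submodule.Quotient.eq] using this
  -- products vanish
  have e3 : ∀ i j k l, i < N → j < N → k < N → l < N → (C i - C j) * (C k - C l) = 0 := by
    intro i j k l hi hj hk hl
    ext v
    have := e1 i j hi hj _ (e2 k l hk hl v)
    simp only [Module.End.mul_apply, LinearMap.sub_apply, LinearMap.zero_apply]
    rw [this, sub_self]
  have e4 : ∀ i j k l m, i < N → j < N → k < N → l < N → m < N →
      (C i - C j) * C m * (C k - C l) = 0 := by
    intro i j k l m hi hj hk hl hm
    ext v
    have := e1 i j hi hj _ (h m hm _ (e2 k l hk hl v))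
    simp only [Module.End.mul_apply, LinearMap.sub_apply, LinearMap.zero_apply] at this ⊢
    rw [this, sub_self]
  -- far differences commute with everything
  have e5 : ∀ i j m, i < N → j < N → m < N → (i + 2 ≤ j ∨ j + 2 ≤ i) →
      C m * (C i - C j) = (C i - C j) * C m := by
    intro i j m hi hj hm hij
    have hc := hC.far hi hj (by omega)
    have a1 := e3 m i i j hm hi hi hj
    have a2 := e3 i j m i hi hj hm hi
    have a3 : C i * (C i - C j) = (C i - C j) * C i := by
      rw [mul_sub, sub_mul, hc]
    rw [sub_mul, sub_eq_zero] at a1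
    rw [mul_sub, sub_eq_zero] at a2
    rw [a1, a2, a3]
  have e6 : ∀ i j m, i < N → j < N → m < N → C m * (C i - C j) = (C i - C j) * C m := by
    -- two-step
    have key : ∀ i j k m, i < N → j < N → k < N → m < N →
        C m * (C i - C k) = (C i - C k) * C m → C m * (C k - C j) = (C k - C j) * C m →
        C m * (C i - C j) = (C i - C j) * C m := by
      intro i j k m _ _ _ _ h1 h2
      rw [show C i - C j = (C i - C k) + (C k - C j) by abel, mul_add, add_mul, h1, h2]
    have to0 : ∀ i m, i < N → m < N → C m * (C i - C 0) = (C i - C 0) * C m := by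
      intro i m hi hm
      rcases Nat.lt_or_ge i 2 with h | h
      · refine key i 0 3 m hi (by omega) (by omega) hm (e5 i 3 m hi (by omega) hm (by omega))
          (e5 3 0 m (by omega) (by omega) hm (by omega))
      · exact e5 i 0 m hi (by omega) hm (by omega)
    intro i j m hi hj hm
    rw [show C i - C j = (C i - C 0) - (C j - C 0) by abel, mul_sub, sub_mul, to0 i m hi hm,
      to0 j m hj hm]
  apply allEq_of_adj
  intro i hi
  apply hC.eq_of_comm hi
  have := e6 i (i+1) i (by omega) hi (by omega)
  rw [mul_sub, sub_mul] at this
  simpa using this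
end

section
variable {V : Type} [AddCommGroup V] [Module ℂ V]

lemma Br.allEq_of_tail {N : ℕ} (hN : 4 ≤ N) {C : ℕ → Module.End ℂ V} (hC : Br N C)
    (h : AllEq (N - 2) (fun i => C (i + 2))) : AllEq N C := by
  have h23 : ∀ i, 2 ≤ i → i + 1 < N → C i = C (i + 1) := by
    intro i hi hi2
    have := h (i - 2) (by omega) (i - 1) (by omega)
    simp only at this
    rwa [show i - 2 + 2 = i by omega, show i - 1 + 2 = i + 1 by omega] at this
  have h12 : C 1 = C 2 := by
    apply hC.eq_of_comm (by omega)
    have := hC.comm 1 3 (by omega) (by omega)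
    rwa [← h23 2 le_rfl (by omega)] at this
  have h01 : C 0 = C 1 := by
    apply hC.eq_of_comm (by omega)
    have := hC.comm 0 2 (by omega) (by omega)
    rwa [← h12] at this
  apply allEq_of_adj
  intro i hi
  match i with
  | 0 => exact h01
  | 1 => exact h12
  | k + 2 => exact h23 _ (by omega) hi

/-- `C i - l` -/
noncomputable def AA (C : ℕ → Module.End ℂ V) (l : ℂ) (i : ℕ) : Module.End ℂ V :=
  C i - l • (1 : Module.End ℂ V)

lemma AA_apply (C : ℕ → Module.End ℂ V) (l : ℂ) (i : ℕ) (v : V) : AA C l i v = C i v - l • v := by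
  simp [AA]

lemma commK [FiniteDimensional ℂ V] {M f : ℕ} (hM : 4 ≤ M) (hP : PP M f)
    {C : ℕ → Module.End ℂ V} (hC : Br M C) (X : Module.End ℂ V)
    (hX : ∀ i, i < M → C i * X = X * C i) (hne : ¬ AllEq M C) :
    ∃ l : ℂ, Module.finrank ℂ (LinearMap.range (X - l • (1 : Module.End ℂ V))) + (f + 1)
      ≤ Module.finrank ℂ V := by
  induction hd : Module.finrank ℂ V using Nat.strong_induction_on generalizing V with
  | _ d ih =>
  have hdf : f + 1 ≤ d := by
    by_contra hlt
    exact hne (hP V C hC (by omega))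
  have : Nontrivial V := Module.nontrivial_of_finrank_pos (R := ℂ) (by omega)
  obtain ⟨l, hl⟩ := Module.End.exists_eigenvalue X
  set E := LinearMap.ker (X - l • (1 : Module.End ℂ V)) with hE
  have memE : ∀ v, v ∈ E ↔ X v = l • v := by
    intro v; simp [hE, sub_eq_zero]
  have hinv : ∀ i, i < M → ∀ v ∈ E, C i v ∈ E := by
    intro i hi v hv
    rw [memE] at hv ⊢
    have := LinearMap.congr_fun (hX i hi) v
    simp only [Module.End.mul_apply] at this
    rw [← this, hv, map_smul]
  have hXE : ∀ v ∈ E, X v ∈ E := by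
    intro v hv
    rw [(memE v).1 hv]
    exact E.smul_mem _ hv
  have hrn := LinearMap.finrank_range_add_finrank_ker (X - l • (1 : Module.End ℂ V))
  rw [← hE, hd] at hrn
  by_cases h1 : AllEq M (resC E C)
  · have h2 : ¬ AllEq M (quoC E C) := fun h2 => hne (hC.ext hM E hinv h1 h2)
    have hEpos : 0 < Module.finrank ℂ E := by
      obtain ⟨v, hv⟩ := hl.exists_hasEigenvector
      have hvE : v ∈ E := (memE v).2 hv.apply_eq_smul
      have : Nontrivial E := ⟨⟨⟨v, hvE⟩, 0, fun h => hv.2 (congrArg Subtype.val h)⟩⟩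
      exact Module.finrank_pos
    have hq := Submodule.finrank_quotient_add_finrank E
    obtain ⟨l', hl'⟩ := ih (Module.finrank ℂ (V ⧸ E)) (by omega) (hC.quo E hinv)
      (E.mapQ E X hXE) (by
        intro i hi
        ext v
        have := congrArg E.mkQ (LinearMap.congr_fun (hX i hi) v)
        simp only [Module.End.mul_apply] at this
        simp only [LinearMap.comp_apply, Module.End.mul_apply]
        rw [quoC_apply (hinv i hi)]
        have e : ∀ w, E.mapQ E X hXE (E.mkQ w) = E.mkQ (X w) := fun w => rfl
        rw [e, e, quoC_apply (hinv i hi), this]) h2 rfl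
    refine ⟨l', ?_⟩
    set Y := X - l' • (1 : Module.End ℂ V)
    have hr : (LinearMap.range Y).map E.mkQ
        = LinearMap.range (E.mapQ E X hXE - l' • (1 : Module.End ℂ (V ⧸ E))) := by
      rw [← LinearMap.range_comp]
      have : E.mkQ ∘ₗ Y = (E.mapQ E X hXE - l' • (1 : Module.End ℂ (V ⧸ E))) ∘ₗ E.mkQ := by
        ext v
        simp [Y]
      rw [this, LinearMap.range_comp, Submodule.range_mkQ, Submodule.map_top]
    have h3 := LinearMap.finrank_range_add_finrank_ker (E.mkQ.domRestrict (LinearMap.range Y))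
    rw [LinearMap.range_domRestrict, hr] at h3
    have h4 : Module.finrank ℂ (LinearMap.ker (E.mkQ.domRestrict (LinearMap.range Y)))
        ≤ Module.finrank ℂ E := by
      have hk : ∀ x : LinearMap.ker (E.mkQ.domRestrict (LinearMap.range Y)), ((x : LinearMap.range Y) : V) ∈ E := by
        intro x
        have := LinearMap.mem_ker.1 x.2
        rw [LinearMap.domRestrict_apply] at this
        exact (Submodule.Quotient.mk_eq_zero E).1 this
      refine LinearMap.finrank_le_finrank_of_injective (f := (((LinearMap.range Y).subtype ∘ₗ
        (LinearMap.ker (E.mkQ.domRestrict (LinearMap.range Y))).subtype).codRestrict E hk)) ?_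
      intro x y hxy
      have := congrArg Subtype.val hxy
      exact Subtype.ext (Subtype.ext this)
    omega
  · refine ⟨l, ?_⟩
    have : f + 1 ≤ Module.finrank ℂ E := by
      by_contra hlt
      exact h1 (hP E _ (hC.res E hinv) (by omega))
    omega

/-! ### conjugation -/

lemma Br.conj {N : ℕ} {C : ℕ → Module.End ℂ V} (hC : Br N C) {i : ℕ} (hi : i + 1 < N) (l : ℂ) :
    (C i * C (i + 1)) * AA C l i = AA C l (i + 1) * (C i * C (i + 1)) := by
  have := hC.braid i hi
  simp only [AA, mul_sub, sub_mul, this, ← mul_assoc]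
  simp

lemma Br.conj3 {N : ℕ} {C : ℕ → Module.End ℂ V} (hC : Br N C) {i : ℕ} (hi : i + 2 < N) (l : ℂ) :
    (C i * C (i + 1) * C (i + 2)) * AA C l i = AA C l (i + 1) * (C i * C (i + 1) * C (i + 2)) ∧
    (C i * C (i + 1) * C (i + 2)) * AA C l (i + 1) =
      AA C l (i + 2) * (C i * C (i + 1) * C (i + 2)) := by
  have b1 := hC.braid i (by omega)
  have b2 := hC.braid (i + 1) (by omega)
  have c := hC.comm i (i + 2) le_rfl hi
  simp only [show i + 1 + 1 = i + 2 from rfl] at b2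
  constructor
  · have : (C i * C (i + 1) * C (i + 2)) * C i = C (i + 1) * (C i * C (i + 1) * C (i + 2)) := by
      rw [mul_assoc, ← c, ← mul_assoc, b1]; simp only [mul_assoc]
    simp only [AA, mul_sub, sub_mul, this]
    simp
  · have : (C i * C (i + 1) * C (i + 2)) * C (i + 1)
        = C (i + 2) * (C i * C (i + 1) * C (i + 2)) := by
      calc _ = C i * (C (i + 1) * C (i + 2) * C (i + 1)) := by simp only [mul_assoc]
        _ = C i * C (i + 2) * C (i + 1) * C (i + 2) := by rw [b2]; simp only [mul_assoc]
        _ = _ := by rw [c]; simp only [mul_assoc]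
    simp only [AA, mul_sub, sub_mul, this]
    simp

lemma finrank_range_conj {g A B : Module.End ℂ V} (hg : IsUnit g) (h : g * A = B * g) :
    Module.finrank ℂ (LinearMap.range B) = Module.finrank ℂ (LinearMap.range A) := by
  have hb := (Module.End.isUnit_iff g).1 hg
  have h1 : LinearMap.range B = LinearMap.range (B * g) := by
    rw [Module.End.mul_eq_comp, LinearMap.range_comp_of_range_eq_top _ (LinearMap.range_eq_top.2 hb.2)]
  rw [h1, ← h, Module.End.mul_eq_comp, LinearMap.range_comp]
  exact LinearEquiv.finrank_map_eq (LinearEquiv.ofBijective g hb) _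

lemma Br.finrank_AA {N : ℕ} {C : ℕ → Module.End ℂ V} (hC : Br N C) (l : ℂ) :
    ∀ i, i < N → Module.finrank ℂ (LinearMap.range (AA C l i)) =
      Module.finrank ℂ (LinearMap.range (AA C l 0)) := by
  intro i
  induction i with
  | zero => intro _; rfl
  | succ k ih =>
    intro hk
    rw [← ih (by omega)]
    exact finrank_range_conj ((hC.unit k (by omega)).mul (hC.unit _ hk)) (hC.conj hk l)

lemma Br.AA_ne {N : ℕ} {C : ℕ → Module.End ℂ V} (hC : Br N C) (l : ℂ) (h0 : AA C l 0 ≠ 0) :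
    ∀ i, i < N → AA C l i ≠ 0 := by
  intro i
  induction i with
  | zero => intro _; exact h0
  | succ k ih =>
    intro hk h
    have := hC.conj hk l
    rw [h, zero_mul] at this
    exact ih (by omega) (((hC.unit k (by omega)).mul (hC.unit _ hk)).mul_right_eq_zero.1 this)

lemma AA_comm {C : ℕ → Module.End ℂ V} (l : ℂ) {i j : ℕ} (h : C i * C j = C j * C i) :
    AA C l i * AA C l j = AA C l j * AA C l i := by
  simp only [AA, mul_sub, sub_mul, h]
  simp
  abel

lemma AA_comm' {C : ℕ → Module.End ℂ V} (l : ℂ) {i j : ℕ} (h : C i * C j = C j * C i) :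
    C i * AA C l j = AA C l j * C i := by
  simp only [AA, mul_sub, sub_mul, h]
  simp

/-- The product of far generators (minus `l`) vanishes. -/
lemma Br.far_zero [FiniteDimensional ℂ V] {N k : ℕ} (hN : 4 ≤ N) (hP : PP (N - 2) k)
    {C : ℕ → Module.End ℂ V} (hC : Br N C) (hI : Irr N C) (l : ℂ)
    (hk : Module.finrank ℂ (LinearMap.range (AA C l 0)) ≤ k) (hkd : k < Module.finrank ℂ V) :
    ∀ i j, i < N → j < N → (i + 2 ≤ j ∨ j + 2 ≤ i) → AA C l i * AA C l j = 0 := by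
  -- first end
  have hinvgen : ∀ i j, i < N → j < N → (i + 2 ≤ j ∨ j + 2 ≤ i) →
      ∀ v ∈ LinearMap.range (AA C l i), C j v ∈ LinearMap.range (AA C l i) := by
    rintro i j hi hj hij _ ⟨w, rfl⟩
    refine ⟨C j w, ?_⟩
    have := LinearMap.congr_fun (AA_comm' l (hC.far hj hi (by omega))) w
    simpa using this.symm
  have h0 : ∀ j, 2 ≤ j → j < N → AA C l j * AA C l 0 = AA C l (N - 1) * AA C l 0 := by
    have hb : Br (N - 2) (fun i => C (i + 2)) := by
      apply Br.shift
      rwa [show N - 2 + 2 = N by omega]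
    have hi : ∀ i, i < N - 2 → ∀ v ∈ LinearMap.range (AA C l 0),
        (fun i => C (i + 2)) i v ∈ LinearMap.range (AA C l 0) :=
      fun i hi => hinvgen 0 (i + 2) (by omega) (by omega) (by omega)
    have hall := hP _ _ (hb.res _ hi) hk
    intro j hj hjN
    ext v
    have := congrArg Subtype.val (LinearMap.congr_fun (hall (j - 2) (by omega) (N - 3) (by omega))
      ⟨AA C l 0 v, ⟨v, rfl⟩⟩)
    rw [resC_apply (C := fun i => C (i + 2)) (hi (j - 2) (by omega)),
      resC_apply (C := fun i => C (i + 2)) (hi (N - 3) (by omega))] at this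
    simp only [show j - 2 + 2 = j by omega, show N - 3 + 2 = N - 1 by omega] at this
    simp only [Module.End.mul_apply]
    rw [AA_apply, AA_apply C l (N - 1), this]
  have h1 : ∀ j, j + 2 < N → AA C l j * AA C l (N - 1) = AA C l 0 * AA C l (N - 1) := by
    have hb : Br (N - 2) C := hC.mono (by omega)
    have hi : ∀ i, i < N - 2 → ∀ v ∈ LinearMap.range (AA C l (N - 1)),
        C i v ∈ LinearMap.range (AA C l (N - 1)) :=
      fun i hi => hinvgen (N - 1) i (by omega) (by omega) (by omega)
    have hall := hP _ _ (hb.res _ hi) (by rw [hC.finrank_AA l _ (by omega)]; exact hk)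
    intro j hj
    ext v
    have := congrArg Subtype.val (LinearMap.congr_fun (hall j (by omega) 0 (by omega))
      ⟨AA C l (N - 1) v, ⟨v, rfl⟩⟩)
    rw [resC_apply (hi _ (by omega)), resC_apply (hi _ (by omega))] at this
    simp only [Module.End.mul_apply]
    rw [AA_apply, AA_apply C l 0, this]
  have hT : AA C l 0 * AA C l (N - 1) = AA C l (N - 1) * AA C l 0 :=
    AA_comm l (hC.far (by omega) (by omega) (by omega))
  -- T is central
  have hcen : ∀ i, i < N → C i * (AA C l 0 * AA C l (N - 1)) = (AA C l 0 * AA C l (N - 1)) * C i := by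
    have gen : ∀ i a b, i < N → a < N → b < N → (i + 2 ≤ a ∨ a + 2 ≤ i ∨ i = a) →
        (i + 2 ≤ b ∨ b + 2 ≤ i ∨ i = b) →
        C i * (AA C l a * AA C l b) = (AA C l a * AA C l b) * C i := by
      intro i a b hi ha hb hia hib
      rw [← mul_assoc, AA_comm' l (hC.far hi ha hia), mul_assoc, AA_comm' l (hC.far hi hb hib),
        mul_assoc]
    intro i hi
    by_cases hi1 : i = 1
    · rw [← h1 1 (by omega)]
      exact gen i 1 (N - 1) hi (by omega) (by omega) (by omega) (by omega)
    by_cases hi2 : i = N - 2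
    · rw [hT, ← h0 (N - 2) (by omega) (by omega)]
      exact gen i (N - 2) 0 hi (by omega) (by omega) (by omega) (by omega)
    exact gen i 0 (N - 1) hi (by omega) (by omega) (by omega) (by omega)
  have hT0 : AA C l 0 * AA C l (N - 1) = 0 := by
    set T := AA C l 0 * AA C l (N - 1) with hTdef
    have hin : ∀ i, i < N → ∀ v ∈ LinearMap.ker T, C i v ∈ LinearMap.ker T := by
      intro i hi v hv
      rw [LinearMap.mem_ker] at hv ⊢
      have := LinearMap.congr_fun (hcen i hi) v
      simp only [Module.End.mul_apply (C i), Module.End.mul_apply T (C i)] at this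
      rw [← this, hv, map_zero]
    rcases hI _ hin with h | h
    · exfalso
      have h3 := LinearMap.finrank_range_add_finrank_ker T
      rw [h, finrank_bot] at h3
      have h4 : Module.finrank ℂ (LinearMap.range T) ≤
          Module.finrank ℂ (LinearMap.range (AA C l 0)) :=
        Submodule.finrank_mono (LinearMap.range_comp_le_range _ _)
      omega
    · exact LinearMap.ker_eq_top.1 h
  have hz : ∀ i j, i + 2 ≤ j → j < N → AA C l i * AA C l j = 0 := by
    intro i
    induction i with
    | zero =>
      intro j hij hj
      rw [AA_comm l (hC.far (by omega) hj (by omega)), h0 j (by omega) hj, ← hT, hT0]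
    | succ i ih =>
      intro j hij hj
      have hu : IsUnit (C i * C (i + 1)) := (hC.unit i (by omega)).mul (hC.unit _ (by omega))
      apply hu.mul_left_eq_zero.1
      have e1 : (C i * C (i + 1)) * AA C l j = AA C l j * (C i * C (i + 1)) := by
        rw [mul_assoc, AA_comm' l (hC.far (by omega) hj (by omega)), ← mul_assoc,
          AA_comm' l (hC.far (by omega) hj (by omega)), mul_assoc]
      rw [mul_assoc, ← e1, ← mul_assoc, ← hC.conj (by omega) l, mul_assoc, ih j (by omega) hj,
        mul_zero]
  intro i j hi hj hij
  rcases hij with h | h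
  · exact hz i j h hj
  · rw [AA_comm l (hC.far hi hj (by omega)), hz j i h hi]
end

section
variable {V : Type} [AddCommGroup V] [Module ℂ V]

lemma PP_of_irr {N d : ℕ} (hN : 4 ≤ N)
    (H : ∀ (V : Type) [AddCommGroup V] [Module ℂ V] [FiniteDimensional ℂ V]
      (C : ℕ → Module.End ℂ V), Br N C → Module.finrank ℂ V ≤ d → Irr N C → AllEq N C) :
    PP N d := by
  intro V _ _ _ C hC hd
  induction hr : Module.finrank ℂ V using Nat.strong_induction_on generalizing V with
  | _ r ih =>
  by_cases hI : Irr N C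
  · exact H V C hC hd hI
  · simp only [Irr, not_forall, not_or] at hI
    obtain ⟨p, hp, hbot, htop⟩ := hI
    have h1 : Module.finrank ℂ p < r := by
      rw [← hr]; exact Submodule.finrank_lt htop
    have h2 := Submodule.finrank_quotient_add_finrank p
    have h3 : 0 < Module.finrank ℂ p := by
      rw [Nat.pos_iff_ne_zero]
      intro h
      exact hbot (Submodule.finrank_eq_zero.1 h)
    exact hC.ext hN p hp (ih _ h1 p _ (hC.res p hp) (by omega) rfl)
      (ih (Module.finrank ℂ (V ⧸ p)) (by omega) _ _ (hC.quo p hp) (by omega) rfl)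

lemma scalar_of_finrank_le_one [FiniteDimensional ℂ V] (h : Module.finrank ℂ V ≤ 1)
    (X Y : Module.End ℂ V) : X * Y = Y * X := by
  obtain ⟨v, hv⟩ := finrank_le_one_iff.1 h
  have key : ∀ Z : Module.End ℂ V, ∃ c : ℂ, ∀ w, Z w = c • w := by
    intro Z
    obtain ⟨c, hc⟩ := hv (Z v)
    refine ⟨c, fun w => ?_⟩
    obtain ⟨a, rfl⟩ := hv w
    rw [map_smul, ← hc, smul_comm]
  obtain ⟨a, ha⟩ := key X
  obtain ⟨b, hb⟩ := key Y
  ext w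
  simp only [Module.End.mul_apply, ha, hb, smul_comm a b]

lemma PP_one (N : ℕ) : PP N 1 := by
  intro V _ _ _ C hC hd
  apply allEq_of_adj
  intro i hi
  exact hC.eq_of_comm hi (scalar_of_finrank_le_one hd _ _)

lemma PP.mono {N d e : ℕ} (h : PP N d) (hed : e ≤ d) : PP N e :=
  fun V _ _ _ C hC hd => h V C hC (hd.trans hed)

lemma C_eq (C : ℕ → Module.End ℂ V) (l : ℂ) (i : ℕ) : C i = AA C l i + l • 1 := by
  simp [AA]

lemma Br.Q_eq {N : ℕ} {C : ℕ → Module.End ℂ V} (hC : Br N C) (l : ℂ) {i : ℕ} (hi : i + 1 < N) :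
    l • (AA C l i * C i) + AA C l i * AA C l (i + 1) * AA C l i =
    l • (AA C l (i + 1) * C (i + 1)) + AA C l (i + 1) * AA C l i * AA C l (i + 1) := by
  have h := hC.braid i hi
  rw [C_eq C l i, C_eq C l (i + 1)] at h ⊢
  have e : ∀ j, AA (fun j => AA C l j + l • (1 : Module.End ℂ V)) l j = AA C l j := by
    intro j; simp [AA]
  generalize AA C l i = A at *
  generalize AA C l (i + 1) = B at *
  simp only [add_mul, mul_add, smul_mul_assoc, mul_smul_comm, one_mul, mul_one, smul_add] at h ⊢
  linear_combination (norm := module) h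

lemma l_ne_zero [FiniteDimensional ℂ V] {N : ℕ} (hN : 0 < N) {C : ℕ → Module.End ℂ V}
    (hC : Br N C) (l : ℂ)
    (h : Module.finrank ℂ (LinearMap.range (AA C l 0)) < Module.finrank ℂ V) : l ≠ 0 := by
  rintro rfl
  have h1 : AA C 0 0 = C 0 := by simp [AA]
  have h2 := (LinearMap.isUnit_iff_range_eq_top _).1 (hC.unit 0 hN)
  rw [h1, h2, finrank_top] at h
  exact lt_irrefl _ h

/-- far products vanish -/
def Far (N : ℕ) (C : ℕ → Module.End ℂ V) (l : ℂ) : Prop :=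
  ∀ i j, i < N → j < N → (i + 2 ≤ j ∨ j + 2 ≤ i) → AA C l i * AA C l j = 0

lemma Br.unit3 {N : ℕ} {C : ℕ → Module.End ℂ V} (hC : Br N C) {i : ℕ} (hi : i + 2 < N) :
    IsUnit (C i * C (i + 1) * C (i + 2)) :=
  ((hC.unit i (by omega)).mul (hC.unit _ (by omega))).mul (hC.unit _ (by omega))

lemma Br.adj_ne {N : ℕ} (hN : 4 ≤ N) {C : ℕ → Module.End ℂ V} (hC : Br N C) {l : ℂ} (hl : l ≠ 0)
    (hF : Far N C l) (hne : ¬ AllEq N C) :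
    ∀ i, i + 1 < N → AA C l (i + 1) * AA C l i ≠ 0 := by
  have fwd : ∀ i, i + 2 < N → (C i * C (i + 1) * C (i + 2)) * (AA C l (i + 1) * AA C l i) =
      (AA C l (i + 2) * AA C l (i + 1)) * (C i * C (i + 1) * C (i + 2)) := by
    intro i hi
    obtain ⟨h1, h2⟩ := hC.conj3 hi l
    rw [← mul_assoc, h2, mul_assoc, h1]
    simp only [mul_assoc]
  have h0 : AA C l 1 * AA C l 0 ≠ 0 := by
    intro h0
    have hall : ∀ i, i + 1 < N → AA C l (i + 1) * AA C l i = 0 := by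
      intro i
      induction i with
      | zero => intro _; exact h0
      | succ i ih =>
        intro hi
        have := fwd i hi
        rw [ih (by omega), mul_zero] at this
        exact (hC.unit3 hi).mul_left_eq_zero.1 this.symm
    have hY : ∀ i, i < N → AA C l i * C i = AA C l 0 * C 0 := by
      intro i
      induction i with
      | zero => intro _; rfl
      | succ i ih =>
        intro hi
        have := hC.Q_eq l hi
        rw [mul_assoc, hall i hi, mul_zero, zero_mul, add_zero, add_zero] at this
        rw [← ih (by omega)]
        exact (smul_right_injective _ hl this).symm
    have hsq : ∀ i, i < N → AA C l i * AA C l i = 0 := by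
      intro i hi
      obtain ⟨j, hj, hij⟩ : ∃ j, j < N ∧ (i + 2 ≤ j ∨ j + 2 ≤ i) := by
        by_cases h : i ≤ 1
        · exact ⟨3, by omega, by omega⟩
        · exact ⟨0, by omega, by omega⟩
      have e : AA C l i * (AA C l i * C i) = AA C l i * (AA C l j * C j) := by
        rw [hY i hi, hY j hj]
      rw [← mul_assoc, ← mul_assoc, hF i j hi hj hij, zero_mul] at e
      exact (hC.unit i hi).mul_left_eq_zero.1 e
    have hA : ∀ i, i < N → AA C l i = AA C l 0 := by
      intro i hi
      have := hY i hi
      rw [C_eq C l i, C_eq C l 0] at this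
      have e : ∀ j, j < N → AA C l j * (AA C l j + l • 1) = l • AA C l j := by
        intro j hj
        rw [mul_add, hsq j hj, zero_add, mul_smul_comm, mul_one]
      rw [e i hi, e 0 (by omega)] at this
      exact smul_right_injective _ hl this
    apply hne
    intro i hi j hj
    rw [C_eq C l i, C_eq C l j, hA i hi, hA j hj]
  intro i
  induction i with
  | zero => intro _; exact h0
  | succ i ih =>
    intro hi h
    have := fwd i hi
    rw [show AA C l (i + 2) * AA C l (i + 1) = 0 from h, zero_mul] at this
    exact ih (by omega) ((hC.unit3 hi).mul_right_eq_zero.1 this)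

/-- partial sums of images -/
noncomputable def SS (C : ℕ → Module.End ℂ V) (l : ℂ) : ℕ → Submodule ℂ V
  | 0 => ⊥
  | j + 1 => SS C l j ⊔ LinearMap.range (AA C l j)

lemma SS_le_ker {N : ℕ} {C : ℕ → Module.End ℂ V} {l : ℂ} (hF : Far N C l) :
    ∀ j k, j < k → k < N → SS C l j ≤ LinearMap.ker (AA C l k) := by
  intro j
  induction j with
  | zero => intro k _ _; exact bot_le
  | succ j ih =>
    intro k hjk hk
    refine sup_le (ih k (by omega) hk) ?_
    rintro _ ⟨v, rfl⟩
    exact LinearMap.congr_fun (hF k j hk (by omega) (by omega)) v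

lemma dim_lower [FiniteDimensional ℂ V] {N : ℕ} (hN : 4 ≤ N) {C : ℕ → Module.End ℂ V} (hC : Br N C) {l : ℂ}
    (hl : l ≠ 0) (hF : Far N C l) (hne : ¬ AllEq N C) : N - 1 ≤ Module.finrank ℂ V := by
  have : ∀ j, j < N → j ≤ Module.finrank ℂ (SS C l j) := by
    intro j
    induction j with
    | zero => intro _; omega
    | succ j ih =>
      intro hj
      have h1 := ih (by omega)
      have h2 : SS C l j < SS C l (j + 1) := by
        refine lt_of_le_of_ne le_sup_left ?_
        intro h
        apply hC.adj_ne hN hl hF hne j hj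
        ext v
        have hv : AA C l j v ∈ SS C l j := by
          rw [h]; exact Submodule.mem_sup_right ⟨v, rfl⟩
        exact SS_le_ker hF j (j + 1) (by omega) hj hv
      have := Submodule.finrank_lt_finrank_of_lt h2
      omega
  exact (this (N - 1) (by omega)).trans (Submodule.finrank_le _)

lemma allEq_of_AA_zero {N : ℕ} {C : ℕ → Module.End ℂ V} (hC : Br N C) {l : ℂ}
    (h : AA C l 0 = 0) : AllEq N C := by
  have : ∀ i, i < N → AA C l i = 0 := by
    intro i
    induction i with
    | zero => intro _; exact h
    | succ k ih =>
      intro hk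
      have := hC.conj hk l
      rw [ih (by omega), mul_zero] at this
      exact ((hC.unit k (by omega)).mul (hC.unit _ hk)).mul_left_eq_zero.1 this.symm
  intro i hi j hj
  rw [C_eq C l i, C_eq C l j, this i hi, this j hj]

lemma no_line [FiniteDimensional ℂ V] {N : ℕ} (hN : 4 ≤ N) {C : ℕ → Module.End ℂ V} (hC : Br N C)
    (hI : Irr N C) (hd : 2 ≤ Module.finrank ℂ V)
    (h : ∀ l, Module.finrank ℂ (LinearMap.ker (AA C l 0)) ≤ 1) : False := by
  have : Nontrivial V := Module.nontrivial_of_finrank_pos (R := ℂ) (by omega)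
  have hk : ∀ l i, i < N → Module.finrank ℂ (LinearMap.ker (AA C l i)) ≤ 1 := by
    intro l i hi
    have h1 := LinearMap.finrank_range_add_finrank_ker (AA C l i)
    have h2 := LinearMap.finrank_range_add_finrank_ker (AA C l 0)
    have h3 := hC.finrank_AA l i hi
    have := h l
    omega
  obtain ⟨l, hl⟩ := Module.End.exists_eigenvalue (C 0)
  obtain ⟨v, hv⟩ := hl.exists_hasEigenvector
  have hv0 := hv.2
  have hv1 : C 0 v = l • v := hv.apply_eq_smul
  have inv : ∀ (m : ℂ) (i j : ℕ), i < N → j < N → (i + 2 ≤ j ∨ j + 2 ≤ i ∨ i = j) → C i v = m • v →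
      C i (C j v) = m • C j v := by
    intro m i j hi hj hij h
    have := LinearMap.congr_fun (hC.far hi hj hij) v
    simp only [Module.End.mul_apply] at this
    rw [this, h, map_smul]
  have line : ∀ (m : ℂ) (i : ℕ), i < N → C i v = m • v → ∀ w, C i w = m • w → ∃ c : ℂ, w = c • v := by
    intro m i hi h w hw
    have hvk : v ∈ LinearMap.ker (AA C m i) := by
      rw [LinearMap.mem_ker, AA_apply, h, sub_self]
    have hwk : w ∈ LinearMap.ker (AA C m i) := by
      rw [LinearMap.mem_ker, AA_apply, hw, sub_self]
    have hle : Submodule.span ℂ {v} ≤ LinearMap.ker (AA C m i) := by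
      rw [Submodule.span_singleton_le_iff_mem]; exact hvk
    have heq := Submodule.eq_of_le_of_finrank_le hle (by
      rw [finrank_span_singleton hv0]; exact hk m i hi)
    rw [← heq] at hwk
    obtain ⟨c, hc⟩ := Submodule.mem_span_singleton.1 hwk
    exact ⟨c, hc.symm⟩
  have sc : ∀ i, i < N → 2 ≤ i → ∃ m : ℂ, C i v = m • v := fun i hi h2 =>
    line l 0 (by omega) hv1 _ (inv l 0 i (by omega) hi (by omega) hv1)
  have sc2 : ∀ i, i < N → ∃ m : ℂ, C i v = m • v := by
    intro i hi
    by_cases h2 : 2 ≤ i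
    · exact sc i hi h2
    · obtain ⟨m, hm⟩ := sc 3 (by omega) (by omega)
      exact line m 3 (by omega) hm _ (inv m 3 i (by omega) hi (by omega) hm)
  have := hI (Submodule.span ℂ {v}) (by
    intro i hi w hw
    obtain ⟨c, rfl⟩ := Submodule.mem_span_singleton.1 hw
    obtain ⟨m, hm⟩ := sc2 i hi
    rw [map_smul, hm]
    exact Submodule.smul_mem _ _ (Submodule.smul_mem _ _ (Submodule.mem_span_singleton_self v)))
  have hf := finrank_span_singleton (K := ℂ) hv0
  rcases this with h | h <;> rw [h] at hf
  · simp at hf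
  · rw [finrank_top] at hf; omega

/-- corank at most one forces dimension at least `N - 1` -/
lemma rank_one_contra [FiniteDimensional ℂ V] {N : ℕ} (hN : 4 ≤ N)
    {C : ℕ → Module.End ℂ V} (hC : Br N C) (hI : Irr N C) (hne : ¬ AllEq N C)
    (hd : Module.finrank ℂ V ≤ N - 2) (l : ℂ)
    (h : Module.finrank ℂ (LinearMap.range (AA C l 0)) ≤ 1) : False := by
  have hd2 : 1 < Module.finrank ℂ V := by
    by_contra h
    exact hne (PP_one N V C hC (by omega))
  have hl := l_ne_zero (by omega) hC l (by omega)
  have hF : Far N C l := hC.far_zero hN (PP_one _) hI l h hd2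
  have := dim_lower hN hC hl hF hne
  omega

lemma PP_base4 : PP 4 2 := by
  apply PP_of_irr le_rfl
  intro V _ _ _ C hC hd hI
  by_contra hne
  have hd2 : 1 < Module.finrank ℂ V := by
    by_contra h
    exact hne (PP_one _ V C hC (by omega))
  apply no_line le_rfl hC hI hd2
  intro l
  by_contra hlt
  have h1 := LinearMap.finrank_range_add_finrank_ker (AA C l 0)
  exact rank_one_contra le_rfl hC hI hne (by omega) l (by omega)

lemma PP_base5 : PP 5 3 := by
  apply PP_of_irr (by omega)
  intro V _ _ _ C hC hd hI
  by_contra hne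
  have hd2 : 1 < Module.finrank ℂ V := by
    by_contra h
    exact hne (PP_one _ V C hC (by omega))
  apply no_line (by omega) hC hI hd2
  intro l
  by_contra hlt
  have h1 := LinearMap.finrank_range_add_finrank_ker (AA C l 0)
  exact rank_one_contra (by omega) hC hI hne (by omega) l (by omega)

lemma Br.corank [FiniteDimensional ℂ V] {N f : ℕ} (hN : 6 ≤ N) (hP : PP (N - 2) f)
    {C : ℕ → Module.End ℂ V} (hC : Br N C) (hne : ¬ AllEq N C) :
    ∃ l : ℂ, Module.finrank ℂ (LinearMap.range (AA C l 0)) + (f + 1) ≤ Module.finrank ℂ V := by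
  have hb : Br (N - 2) (fun i => C (i + 2)) := by
    apply Br.shift
    rwa [show N - 2 + 2 = N by omega]
  exact commK (by omega) hP hb (C 0)
    (fun i hi => hC.far (by omega) (by omega) (by omega))
    (fun h => hne (hC.allEq_of_tail (by omega) h))

lemma PP_all (N : ℕ) (hN : 4 ≤ N) : PP N (N - 2) := by
  induction N using Nat.strong_induction_on with
  | _ N ih =>
  by_cases h4 : N = 4
  · subst h4; exact PP_base4
  by_cases h5 : N = 5
  · subst h5; exact PP_base5
  apply PP_of_irr hN
  intro V _ _ _ C hC hd hI
  by_contra hne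
  obtain ⟨l, hl⟩ := hC.corank (by omega) (ih (N - 2) (by omega) (by omega)) hne
  exact rank_one_contra hN hC hI hne hd l (by omega)
end

section
variable {V : Type} [AddCommGroup V] [Module ℂ V]

lemma eigen_zero [FiniteDimensional ℂ V] {N : ℕ} {C : ℕ → Module.End ℂ V}
    (hI : Irr N C) (hd : 2 ≤ Module.finrank ℂ V) (v : V)
    (hv : ∀ i, i < N → ∃ m : ℂ, C i v = m • v) : v = 0 := by
  by_contra hv0
  have := hI (Submodule.span ℂ {v}) (by
    intro i hi w hw
    obtain ⟨c, rfl⟩ := Submodule.mem_span_singleton.1 hw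
    obtain ⟨m, hm⟩ := hv i hi
    rw [map_smul, hm]
    exact Submodule.smul_mem _ _ (Submodule.smul_mem _ _ (Submodule.mem_span_singleton_self v)))
  have hf := finrank_span_singleton (K := ℂ) hv0
  rcases this with h | h <;> rw [h] at hf
  · simp at hf
  · rw [finrank_top] at hf; omega

lemma not_allEq [FiniteDimensional ℂ V] {N : ℕ} (hN : 0 < N) {C : ℕ → Module.End ℂ V}
    (hI : Irr N C) (hd : 2 ≤ Module.finrank ℂ V) : ¬ AllEq N C := by
  intro h
  have : Nontrivial V := Module.nontrivial_of_finrank_pos (R := ℂ) (by omega)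
  obtain ⟨l, hl⟩ := Module.End.exists_eigenvalue (C 0)
  obtain ⟨v, hv⟩ := hl.exists_hasEigenvector
  refine hv.2 (eigen_zero hI hd v fun i hi => ⟨l, ?_⟩)
  rw [h i hi 0 hN]
  exact hv.apply_eq_smul

lemma AA_zero_all [FiniteDimensional ℂ V] {N : ℕ} {C : ℕ → Module.End ℂ V}
    (hI : Irr N C) (hd : 2 ≤ Module.finrank ℂ V) (l : ℂ) (v : V)
    (hv : ∀ i, i < N → AA C l i v = 0) : v = 0 := by
  refine eigen_zero hI hd v fun i hi => ⟨l, ?_⟩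
  have := hv i hi
  rwa [AA_apply, sub_eq_zero] at this

lemma range_le_SS (C : ℕ → Module.End ℂ V) (l : ℂ) : ∀ j i, i < j →
    LinearMap.range (AA C l i) ≤ SS C l j := by
  intro j
  induction j with
  | zero => intro i hi; omega
  | succ j ih =>
    intro i hi
    by_cases h : i = j
    · subst h; exact le_sup_right
    · exact (ih i (by omega)).trans le_sup_left

lemma SS_top [FiniteDimensional ℂ V] {N : ℕ} (hN : 0 < N) {C : ℕ → Module.End ℂ V}
    (hI : Irr N C) (l : ℂ) (h0 : AA C l 0 ≠ 0) : SS C l N = ⊤ := by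
  have := hI (SS C l N) (by
    intro i hi v hv
    rw [C_eq C l i]
    simp only [LinearMap.add_apply, LinearMap.smul_apply, Module.End.one_apply]
    exact add_mem (range_le_SS C l N i hi ⟨v, rfl⟩) (Submodule.smul_mem _ _ hv))
  refine this.resolve_left fun h => h0 ?_
  have h1 := range_le_SS C l N 0 hN
  rw [h, le_bot_iff, LinearMap.range_eq_bot] at h1
  exact h1

/-- every third image -/
noncomputable def S3 (C : ℕ → Module.End ℂ V) (l : ℂ) : ℕ → Submodule ℂ V
  | 0 => ⊥
  | j + 1 => S3 C l j ⊔ LinearMap.range (AA C l (3 * j))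

lemma S3_le_ker {N : ℕ} {C : ℕ → Module.End ℂ V} {l : ℂ} (hF : Far N C l) :
    ∀ j k, 3 * j ≤ k + 1 → k < N → S3 C l j ≤ LinearMap.ker (AA C l k) := by
  intro j
  induction j with
  | zero => intro k _ _; exact bot_le
  | succ j ih =>
    intro k hjk hk
    refine sup_le (ih k (by omega) hk) ?_
    rintro _ ⟨v, rfl⟩
    exact LinearMap.congr_fun (hF k (3 * j) hk (by omega) (by omega)) v

lemma S3_finrank [FiniteDimensional ℂ V] {N : ℕ} {C : ℕ → Module.End ℂ V} (hC : Br N C)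
    (hI : Irr N C) (hd : 2 ≤ Module.finrank ℂ V) {l : ℂ} (hF : Far N C l) :
    ∀ j, 3 * j < N + 3 → j * Module.finrank ℂ (LinearMap.range (AA C l 0)) ≤
      Module.finrank ℂ (S3 C l j) := by
  intro j
  induction j with
  | zero => intro _; simp
  | succ j ih =>
    intro hj
    have h1 := ih (by omega)
    have h2 := Submodule.finrank_sup_add_finrank_inf_eq (S3 C l j)
      (LinearMap.range (AA C l (3 * j)))
    have h3 : S3 C l j ⊓ LinearMap.range (AA C l (3 * j)) = ⊥ := by
      rw [eq_bot_iff]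
      rintro x ⟨hx1, hx2⟩
      apply AA_zero_all hI hd l
      intro k hk
      by_cases hjk : 3 * j ≤ k + 1
      · exact S3_le_ker hF j k hjk hk hx1
      · obtain ⟨w, rfl⟩ := hx2
        exact LinearMap.congr_fun (hF k (3 * j) hk (by omega) (by omega)) w
    rw [h3, finrank_bot, hC.finrank_AA l (3 * j) (by omega)] at h2
    rw [S3, add_mul, one_mul]
    omega

/-- the Temperley-Lieb defect -/
noncomputable def QQ (C : ℕ → Module.End ℂ V) (l : ℂ) (i : ℕ) : Module.End ℂ V :=
  l • (AA C l i * C i) + AA C l i * AA C l (i + 1) * AA C l i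

lemma QQ_conj {N : ℕ} {C : ℕ → Module.End ℂ V} (hC : Br N C) (l : ℂ) {i : ℕ} (hi : i + 2 < N) :
    (C i * C (i + 1) * C (i + 2)) * QQ C l i = QQ C l (i + 1) * (C i * C (i + 1) * C (i + 2)) := by
  obtain ⟨h1, h2⟩ := hC.conj3 hi l
  have h3 : (C i * C (i + 1) * C (i + 2)) * C i = C (i + 1) * (C i * C (i + 1) * C (i + 2)) := by
    have := (hC.conj3 hi 0).1
    simpa [AA] using this
  simp only [QQ, show i + 1 + 1 = i + 2 from rfl]
  generalize C i * C (i + 1) * C (i + 2) = g at *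
  have e1 : g * (AA C l i * C i) = AA C l (i + 1) * C (i + 1) * g := by
    rw [← mul_assoc, h1, mul_assoc, h3, mul_assoc]
  have e2 : g * (AA C l i * AA C l (i + 1) * AA C l i) =
      AA C l (i + 1) * AA C l (i + 2) * AA C l (i + 1) * g := by
    rw [← mul_assoc, ← mul_assoc, h1, mul_assoc (AA C l (i + 1)) g, h2, ← mul_assoc, mul_assoc _ g,
      h1, ← mul_assoc]
  rw [mul_add, add_mul, mul_smul_comm, smul_mul_assoc, e1, e2]

/-- the Temperley-Lieb basis -/
noncomputable def tv (C : ℕ → Module.End ℂ V) (l : ℂ) (v : V) : ℕ → V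
  | 0 => v
  | i + 1 => AA C l (i + 1) (tv C l v i)

lemma TL_contra [FiniteDimensional ℂ V] {N : ℕ} (hN : 0 < N) {C : ℕ → Module.End ℂ V} (hC : Br N C)
    (hI : Irr N C) {l : ℂ} (hl : l ≠ 0) (hF : Far N C l) (h0 : AA C l 0 ≠ 0)
    (hd : N < Module.finrank ℂ V) (hQ : ∀ i, i + 1 < N → QQ C l i = 0) : False := by
  -- an eigenvector of `C 0` inside the image of `A 0`
  have hne : LinearMap.range (AA C l 0) ≠ ⊥ := fun h => h0 (LinearMap.range_eq_bot.1 h)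
  have hinv : ∀ v ∈ LinearMap.range (AA C l 0), C 0 v ∈ LinearMap.range (AA C l 0) := by
    rintro _ ⟨w, rfl⟩
    refine ⟨C 0 w, ?_⟩
    exact (LinearMap.congr_fun (AA_comm' (C := C) l (i := 0) (j := 0) rfl) w).symm
  have : Nontrivial (LinearMap.range (AA C l 0)) := Submodule.nontrivial_iff_ne_bot.2 hne
  obtain ⟨m, hm⟩ := Module.End.exists_eigenvalue ((C 0).restrict hinv)
  obtain ⟨⟨v, hvr⟩, hv⟩ := hm.exists_hasEigenvector
  have hv0 : v ≠ 0 := fun h => hv.2 (Subtype.ext h)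
  have hv1 : C 0 v = m • v := congrArg Subtype.val hv.apply_eq_smul
  -- facts about the vectors
  have hmem : ∀ i, tv C l v i ∈ LinearMap.range (AA C l i) := by
    intro i
    cases i with
    | zero => exact hvr
    | succ i => exact ⟨_, rfl⟩
  have hfar : ∀ i j, i < N → j < N → (i + 2 ≤ j ∨ j + 2 ≤ i) → AA C l j (tv C l v i) = 0 := by
    intro i j hi hj hij
    obtain ⟨w, hw⟩ := hmem i
    rw [← hw]
    exact LinearMap.congr_fun (hF j i hj hi (by omega)) w
  have hQ1 : ∀ i, i + 1 < N → ∀ w ∈ LinearMap.range (AA C l i),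
      l • C i w + AA C l i (AA C l (i + 1) w) = 0 := by
    rintro i hi _ ⟨u, rfl⟩
    have := LinearMap.congr_fun (hQ i hi) u
    have e := LinearMap.congr_fun (AA_comm' (C := C) l (i := i) (j := i) rfl) u
    simp only [QQ, LinearMap.add_apply, LinearMap.smul_apply, Module.End.mul_apply,
      LinearMap.zero_apply] at this e
    rwa [e]
  have hQ2 : ∀ i, i + 1 < N → ∀ u, l • C (i + 1) (AA C l (i + 1) u) +
      AA C l (i + 1) (AA C l i (AA C l (i + 1) u)) = 0 := by
    intro i hi u
    have h := hQ i hi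
    rw [QQ, hC.Q_eq l hi] at h
    have := LinearMap.congr_fun h u
    have e := LinearMap.congr_fun (AA_comm' (C := C) l (i := i + 1) (j := i + 1) rfl) u
    simp only [LinearMap.add_apply, LinearMap.smul_apply, Module.End.mul_apply,
      LinearMap.zero_apply] at this e
    rwa [e]
  have hself : ∀ i, i < N → C i (tv C l v i) = m • tv C l v i := by
    intro i
    induction i with
    | zero => intro _; exact hv1
    | succ i ih =>
      intro hi
      have a1 := hQ1 i hi _ (hmem i)
      have a2 := hQ2 i hi (tv C l v i)
      rw [ih (by omega)] at a1
      have a3 : AA C l i (AA C l (i + 1) (tv C l v i)) = -(l • m • tv C l v i) :=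
        eq_neg_of_add_eq_zero_right a1
      rw [a3, map_neg, map_smul, map_smul, ← sub_eq_add_neg, sub_eq_zero] at a2
      exact smul_right_injective _ hl a2
  have hdown : ∀ i, i + 1 < N → AA C l i (tv C l v (i + 1)) = -(l • m • tv C l v i) := by
    intro i hi
    have a1 := hQ1 i hi _ (hmem i)
    rw [hself i (by omega)] at a1
    exact eq_neg_of_add_eq_zero_right a1
  -- span
  set S := Submodule.span ℂ (Set.range fun i : Fin N => tv C l v i) with hS
  have hin : ∀ i, i < N → tv C l v i ∈ S := fun i hi => Submodule.subset_span ⟨⟨i, hi⟩, rfl⟩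
  have hA : ∀ j, j < N → ∀ i, i < N → AA C l j (tv C l v i) ∈ S := by
    intro j hj i hi
    rcases Nat.lt_trichotomy i j with h | h | h
    · by_cases h' : j = i + 1
      · subst h'; exact hin (i + 1) hj
      · rw [hfar i j hi hj (by omega)]; exact S.zero_mem
    · subst h
      rw [AA_apply, hself i hi]
      exact S.sub_mem (S.smul_mem _ (hin i hi)) (S.smul_mem _ (hin i hi))
    · by_cases h' : i = j + 1
      · subst h'
        rw [hdown j hi]
        exact S.neg_mem (S.smul_mem _ (S.smul_mem _ (hin j hj)))
      · rw [hfar i j hi hj (by omega)]; exact S.zero_mem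
  have hinvS : ∀ j, j < N → ∀ w ∈ S, C j w ∈ S := by
    intro j hj w hw
    have hle : S ≤ S.comap (C j) := by
      rw [hS, Submodule.span_le]
      rintro _ ⟨i, rfl⟩
      show C j (tv C l v i) ∈ S
      rw [C_eq C l j]
      simp only [LinearMap.add_apply, LinearMap.smul_apply, Module.End.one_apply]
      exact S.add_mem (hA j hj i i.2) (S.smul_mem _ (hin i i.2))
    exact hle hw
  have hcard : Module.finrank ℂ S ≤ N := by
    have := finrank_range_le_card (R := ℂ) (fun i : Fin N => tv C l v i)
    simpa [Set.finrank] using this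
  rcases hI S hinvS with h | h
  · have := hin 0 hN
    rw [h, Submodule.mem_bot] at this
    exact hv0 this
  · rw [h, finrank_top] at hcard
    omega

lemma QQ_le [FiniteDimensional ℂ V] {N : ℕ} {C : ℕ → Module.End ℂ V} (hC : Br N C)
    (hI : Irr N C) {l : ℂ} (hN : 0 < N) (h0 : AA C l 0 ≠ 0)
    (hk : Module.finrank ℂ (LinearMap.range (AA C l 0)) ≤ 2)
    (hQ : ∀ i, i + 1 < N → QQ C l i ≠ 0) : Module.finrank ℂ V ≤ N + 1 := by
  have : ∀ j, j < N → Module.finrank ℂ (SS C l (j + 1)) ≤ j + 2 := by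
    intro j
    induction j with
    | zero =>
      intro _
      rw [SS, SS, bot_sup_eq]
      exact hk
    | succ j ih =>
      intro hj
      have h1 := ih (by omega)
      have h2 := Submodule.finrank_sup_add_finrank_inf_eq (SS C l (j + 1))
        (LinearMap.range (AA C l (j + 1)))
      rw [hC.finrank_AA l (j + 1) hj] at h2
      have h3 : 0 < Module.finrank ℂ
          ↥(SS C l (j + 1) ⊓ LinearMap.range (AA C l (j + 1))) := by
        rw [Nat.pos_iff_ne_zero]
        intro h
        have hb := Submodule.finrank_eq_zero.1 h
        apply hQ j hj
        ext x
        have hx : QQ C l j x ∈ SS C l (j + 1) ⊓ LinearMap.range (AA C l (j + 1)) := by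
          constructor
          · apply range_le_SS C l (j + 1) j (by omega)
            refine ⟨l • C j x + AA C l (j + 1) (AA C l j x), ?_⟩
            simp [QQ]
          · refine ⟨l • C (j + 1) x + AA C l j (AA C l (j + 1) x), ?_⟩
            rw [QQ, hC.Q_eq l hj]
            simp
        rw [hb] at hx
        exact hx
      rw [SS]
      omega
  have h := this (N - 1) (by omega)
  rw [show N - 1 + 1 = N by omega, SS_top hN hI l h0, finrank_top] at h
  omega

lemma main_lin [FiniteDimensional ℂ V] {N : ℕ} (hN : 9 ≤ N) {C : ℕ → Module.End ℂ V} (hC : Br N C)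
    (hI : Irr N C) (hd : Module.finrank ℂ V = N + 2) :
    ∃ l : ℂ, l ≠ 0 ∧ Module.finrank ℂ (LinearMap.range (AA C l 0)) = 3 := by
  have hne := not_allEq (by omega) hI (by omega)
  have hP := PP_all (N - 2) (by omega)
  obtain ⟨l, hr⟩ := hC.corank (by omega) hP hne
  have hl := l_ne_zero (by omega) hC l (by omega)
  have h0 : AA C l 0 ≠ 0 := fun h => hne (allEq_of_AA_zero hC h)
  have hF : Far N C l := hC.far_zero (by omega) (hP.mono (e := 5) (by omega)) hI l (by omega)
    (by omega)
  refine ⟨l, hl, ?_⟩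
  have h3 : Module.finrank ℂ (LinearMap.range (AA C l 0)) ≤ 3 := by
    have a1 := S3_finrank hC hI (by omega) hF ((N + 2) / 3) (by omega)
    have a2 := Submodule.finrank_le (S3 C l ((N + 2) / 3))
    by_contra hlt
    have a3 : (N + 2) / 3 * 4 ≤ (N + 2) / 3 * Module.finrank ℂ (LinearMap.range (AA C l 0)) :=
      Nat.mul_le_mul_left _ (by omega)
    omega
  by_contra hk
  have hk2 : Module.finrank ℂ (LinearMap.range (AA C l 0)) ≤ 2 := by omega
  by_cases hQ : QQ C l 0 = 0
  · apply TL_contra (by omega) hC hI hl hF h0 (by omega)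
    intro i
    induction i with
    | zero => intro _; exact hQ
    | succ i ih =>
      intro hi
      have := QQ_conj hC l hi
      rw [ih (by omega), mul_zero] at this
      exact (hC.unit3 hi).mul_left_eq_zero.1 this.symm
  · have hall : ∀ i, i + 1 < N → QQ C l i ≠ 0 := by
      intro i
      induction i with
      | zero => intro _; exact hQ
      | succ i ih =>
        intro hi h
        have := QQ_conj hC l hi
        rw [h, zero_mul] at this
        exact ih (by omega) ((hC.unit3 hi).mul_right_eq_zero.1 this)
    have := QQ_le hC hI (by omega) h0 hk2 hall
    omega
end


/-- For `n ≥ 10`, every irreducible representation of `B_n` of dimension `n+1` is a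
tensor product of a one-dimensional representation `χ(y)` and an irreducible
representation of dimension `n+1` and corank `3`. -/
theorem stmt_2 (n : ℕ) (hn : 10 ≤ n)
    (C : ℕ → Matrix (Fin (n + 1)) (Fin (n + 1)) ℂ)
    (hinv : ∀ i, 1 ≤ i → i ≤ n - 1 → IsUnit (C i))
    (hcomm : ∀ i j, 1 ≤ i → i ≤ n - 1 → 1 ≤ j → j ≤ n - 1 → i + 2 ≤ j →
      C i * C j = C j * C i)
    (hbraid : ∀ i, 1 ≤ i → i ≤ n - 2 →
      C i * C (i + 1) * C i = C (i + 1) * C i * C (i + 1))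
    (hirr : ∀ p : Submodule ℂ (Fin (n + 1) → ℂ),
      (∀ i, 1 ≤ i → i ≤ n - 1 → ∀ v ∈ p, (C i).mulVec v ∈ p) → p = ⊥ ∨ p = ⊤) :
    ∃ (y : ℂ) (D : ℕ → Matrix (Fin (n + 1)) (Fin (n + 1)) ℂ), y ≠ 0 ∧
      (∀ i, 1 ≤ i → i ≤ n - 1 → IsUnit (D i)) ∧
      (∀ i j, 1 ≤ i → i ≤ n - 1 → 1 ≤ j → j ≤ n - 1 → i + 2 ≤ j →
        D i * D j = D j * D i) ∧
      (∀ i, 1 ≤ i → i ≤ n - 2 →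
        D i * D (i + 1) * D i = D (i + 1) * D i * D (i + 1)) ∧
      (∀ p : Submodule ℂ (Fin (n + 1) → ℂ),
        (∀ i, 1 ≤ i → i ≤ n - 1 → ∀ v ∈ p, (D i).mulVec v ∈ p) → p = ⊥ ∨ p = ⊤) ∧
      (D 1 - 1).rank = 3 ∧
      (∀ i, 1 ≤ i → i ≤ n - 1 → C i = y • D i) := by
  -- translate to linear maps, generators indexed from 0
  let L : ℕ → Module.End ℂ (Fin (n + 1) → ℂ) := fun i => Matrix.toLinAlgEquiv' (C (i + 1))
  have hLapp : ∀ i v, L i v = (C (i + 1)).mulVec v := fun i v => rfl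
  have hC : Br (n - 1) L := by
    refine ⟨fun i hi => ?_, fun i j hij hj => ?_, fun i hi => ?_⟩
    · exact (hinv (i + 1) (by omega) (by omega)).map
        (Matrix.toLinAlgEquiv' (R := ℂ) (n := Fin (n + 1)))
    · have := hcomm (i + 1) (j + 1) (by omega) (by omega) (by omega) (by omega) (by omega)
      simp only [L, ← map_mul, this]
    · have := hbraid (i + 1) (by omega) (by omega)
      simp only [L, ← map_mul, this]
  have hI : Irr (n - 1) L := by
    intro p hp
    apply hirr p
    intro i h1 h2 v hv
    have := hp (i - 1) (by omega) v hv
    rwa [hLapp, show i - 1 + 1 = i by omega] at this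
  obtain ⟨y, hy, hrank⟩ := main_lin (N := n - 1) (by omega) hC hI (by
    rw [Module.finrank_fin_fun]; omega)
  have hsm : ∀ i, C i = y • (y⁻¹ • C i) := fun i => by rw [smul_smul, mul_inv_cancel₀ hy, one_smul]
  refine ⟨y, fun i => y⁻¹ • C i, hy, ?_, ?_, ?_, ?_, ?_, fun i _ _ => hsm i⟩
  · intro i h1 h2
    exact (hinv i h1 h2).smul (Units.mk0 y⁻¹ (inv_ne_zero hy))
  · intro i j h1 h2 h3 h4 h5
    simp only [smul_mul_assoc, mul_smul_comm, hcomm i j h1 h2 h3 h4 h5]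
  · intro i h1 h2
    simp only [smul_mul_assoc, mul_smul_comm, hbraid i h1 h2]
  · intro p hp
    apply hirr p
    intro i h1 h2 v hv
    have := p.smul_mem y (hp i h1 h2 v hv)
    rwa [← Matrix.smul_mulVec, ← hsm] at this
  · have e : C 1 - y • (1 : Matrix (Fin (n + 1)) (Fin (n + 1)) ℂ) = y • (y⁻¹ • C 1 - 1) := by
      rw [smul_sub, ← hsm]
    have e2 : AA L y 0 = Matrix.mulVecLin (y • (y⁻¹ • C 1 - 1)) := by
      rw [← e]
      ext v
      simp [AA, hLapp, Matrix.sub_mulVec, Matrix.smul_mulVec]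
    rw [e2] at hrank
    have e3 : (y • (y⁻¹ • C 1 - 1)).rank = (y⁻¹ • C 1 - 1).rank := by
      have : Matrix.mulVecLin (y • (y⁻¹ • C 1 - 1)) = y • Matrix.mulVecLin (y⁻¹ • C 1 - 1) := by
        ext v; simp [Matrix.smul_mulVec]
      rw [Matrix.rank, Matrix.rank, this, LinearMap.range_smul _ _ hy]
    rw [← e3]
    exact hrank
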